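/- Let U be a left bialgebroid over A. Under the isomorphism Hom_U(P_p, A) ≅ C^p(U,A), φ̂ ↦ φ := φ̂(1,·), the convolution cup product (φ̂ ⌣ ψ̂)(c) = φ̂(c_{(1)})ψ̂(c_{(2)}) (using the DG coalgebra structure Δ^P on the bar resolution P) corresponds to the explicit formula (φ ⌣ ψ)(u¹,…,u^{p+q}) = φ(u¹,…,u^{p−1}, ψ(u^{p+1},…,u^{p+q}) ▸ u^p). -/

import Mathlib

open Function TensorProduct

noncomputable section

universe u v w

/-- Transport an element of a type family along an equality of indices. -/
def dcast {ι : Sort w} {F : ι → Sort v} {a b : ι} (x : F a) (h : a = b) : F b := h ▸ x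

/-- Transport as a linear equivalence. -/
def dEquiv (k : Type u) [CommRing k] {ι : Type w} (F : ι → Type v)
    [∀ i, AddCommGroup (F i)] [∀ i, Module k (F i)] {a b : ι} (h : a = b) :
    F a ≃ₗ[k] F b := by subst h; exact LinearEquiv.refl k (F a)

/-- A Gerstenhaber algebra over `k` on an `ℕ`-graded family `V`. -/
structure GerstenhaberAlgebra (k : Type u) [CommRing k] (V : ℕ → Type v)
    [∀ p, AddCommGroup (V p)] [∀ p, Module k (V p)] where
  one : V 0
  mul : ∀ {p q : ℕ}, V p →ₗ[k] V q →ₗ[k] V (p + q)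
  /-- The (extended) Gerstenhaber bracket `{·,·} : V^{p+1} ⊗ V^q → V^{p+q}`. -/
  bracket : ∀ {p q : ℕ}, V (p + 1) →ₗ[k] V q →ₗ[k] V (p + q)
  mul_assoc : ∀ {p q r : ℕ} (a : V p) (b : V q) (c : V r),
      mul a (mul b c) = dcast (F := V) (mul (mul a b) c) (by omega)
  one_mul : ∀ {p : ℕ} (a : V p), a = dcast (F := V) (mul one a) (by omega)
  mul_one : ∀ {p : ℕ} (a : V p), mul a one = a
  mul_comm : ∀ {p q : ℕ} (a : V p) (b : V q),
      ((-1 : ℤ) ^ (p * q)) • mul a b = dcast (F := V) (mul b a) (by omega)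
  bracket_antisymm : ∀ {p q : ℕ} (a : V (p + 1)) (b : V (q + 1)),
      bracket a b = -(((-1 : ℤ) ^ (p * q)) • dcast (F := V) (bracket b a) (by omega))
  bracket_jacobi : ∀ {p q r : ℕ} (a : V (p + 1)) (b : V (q + 1)) (c : V r),
      bracket a (bracket b c)
        = dcast (F := V) (bracket (p := p + q) (bracket a b) c) (by omega)
          + ((-1 : ℤ) ^ (p * q)) • dcast (F := V) (bracket b (bracket a c)) (by omega)
  leibniz : ∀ {p q r : ℕ} (γ : V (p + 1)) (a : V q) (b : V r),
      bracket γ (mul a b)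
        = dcast (F := V) (mul (bracket γ a) b) (by omega)
          + ((-1 : ℤ) ^ (p * q)) • dcast (F := V) (mul a (bracket γ b)) (by omega)

/-- A Gerstenhaber module over a Gerstenhaber algebra, on a `ℤ`-graded family `Ω`. -/
structure GerstenhaberModule (k : Type u) [CommRing k] (V : ℕ → Type v)
    [∀ p, AddCommGroup (V p)] [∀ p, Module k (V p)]
    (G : GerstenhaberAlgebra k V) (Ω : ℤ → Type w)
    [∀ z, AddCommGroup (Ω z)] [∀ z, Module k (Ω z)] where
  cap : ∀ {p : ℕ} {z : ℤ}, V p →ₗ[k] Ω z →ₗ[k] Ω (z - p)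
  lie : ∀ {p : ℕ} {z : ℤ}, V (p + 1) →ₗ[k] Ω z →ₗ[k] Ω (z - p)
  cap_one : ∀ {z : ℤ} (x : Ω z), cap G.one x = dcast (F := Ω) x (by omega)
  cap_mul : ∀ {p q : ℕ} {z : ℤ} (α : V p) (β : V q) (x : Ω z),
      cap (G.mul α β) x = dcast (F := Ω) (cap α (cap β x)) (by omega)
  lie_bracket : ∀ {p q : ℕ} {z : ℤ} (α : V (p + 1)) (β : V (q + 1)) (x : Ω z),
      lie (p := p + q) (G.bracket α β) x
        = dcast (F := Ω) (lie α (lie β x)) (by omega)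
          - ((-1 : ℤ) ^ (p * q)) • dcast (F := Ω) (lie β (lie α x)) (by omega)
  mixed_leibniz : ∀ {p q : ℕ} {z : ℤ} (α : V (p + 1)) (β : V q) (x : Ω z),
      cap β (lie α x)
        = dcast (F := Ω) (cap (-(((-1 : ℤ) ^ ((q + 1) * p)) • G.bracket α β)) x) (by omega)
          + ((-1 : ℤ) ^ (p * q)) • dcast (F := Ω) (lie α (cap β x)) (by omega)

/-- A (noncommutative) differential calculus: a Gerstenhaber algebra, a Gerstenhaber
module over it, and a differential `B` satisfying the Batalin-Vilkovisky homotopy formula. -/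
structure DifferentialCalculus (k : Type u) [CommRing k] (V : ℕ → Type v)
    [∀ p, AddCommGroup (V p)] [∀ p, Module k (V p)] (Ω : ℤ → Type w)
    [∀ z, AddCommGroup (Ω z)] [∀ z, Module k (Ω z)] where
  alg : GerstenhaberAlgebra k V
  mod : GerstenhaberModule k V alg Ω
  Bop : ∀ z : ℤ, Ω z →ₗ[k] Ω (z + 1)
  Bop_sq : ∀ (z : ℤ) (x : Ω z), Bop (z + 1) (Bop z x) = 0
  homotopy : ∀ {p : ℕ} {z : ℤ} (α : V (p + 1)) (x : Ω z),
      mod.lie α x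
        = dcast (F := Ω) (Bop (z - (p + 1)) (mod.cap α x)) (by omega)
          - ((-1 : ℤ) ^ (p + 1)) • dcast (F := Ω) (mod.cap α (Bop z x)) (by omega)
section Bialgebroid

variable (k : Type u) [CommRing k] (A U : Type u) [Ring A] [Algebra k A] [Ring U] [Algebra k U]

/-- The sum `Σ xᵢ ⊗ yᵢ` of a list of pairs, in `U ⊗[k] U`. -/
def listTens (l : List (U × U)) : U ⊗[k] U := (l.map fun p => p.1 ⊗ₜ[k] p.2).sum

variable {U} in
/-- The `k`-submodule of `U ⊗[k] U` of relators presenting `U ⊗_A U`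
(with `◁` on the first factor and `▷` on the second one). -/
def midSpan (src tgt : A → U) : Submodule k (U ⊗[k] U) :=
  Submodule.span k {z : U ⊗[k] U | ∃ x y c, z = (tgt c * x) ⊗ₜ[k] y - x ⊗ₜ[k] (src c * y)}

variable {U} in
/-- The `k`-submodule of `U ⊗[k] U` of relators presenting `U ⊗_{A^op} U`
(with `▸` on the first factor and `◁` on the second one). -/
def opSpan (tgt : A → U) : Submodule k (U ⊗[k] U) :=
  Submodule.span k {z : U ⊗[k] U | ∃ x y c, z = (x * tgt c) ⊗ₜ[k] y - x ⊗ₜ[k] (tgt c * y)}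

variable {U} in
/-- Relators in a triple tensor product presenting `U ⊗_A U ⊗_A U`. -/
def midSpan3 (src tgt : A → U) : Submodule k (U ⊗[k] (U ⊗[k] U)) :=
  Submodule.span k
    ({z : U ⊗[k] (U ⊗[k] U) | ∃ x y w c,
        z = (tgt c * x) ⊗ₜ[k] (y ⊗ₜ[k] w) - x ⊗ₜ[k] ((src c * y) ⊗ₜ[k] w)} ∪
     {z : U ⊗[k] (U ⊗[k] U) | ∃ x y w c,
        z = x ⊗ₜ[k] ((tgt c * y) ⊗ₜ[k] w) - x ⊗ₜ[k] (y ⊗ₜ[k] (src c * w))})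

/-- A left bialgebroid (`×_A`-bialgebra) `U` over a possibly noncommutative base `A`.
The coproduct is recorded through a chosen list `comul u` of Sweedler representatives
`u₍₁₎ ⊗ u₍₂₎`; all coalgebra axioms are imposed modulo the relators presenting the
tensor product `U ⊗_A U` inside `U ⊗[k] U`. -/
structure LeftBialgebroid where
  /-- the source map `s : A → U` -/
  src : A →ₐ[k] U
  /-- the target map `t : A^op → U` -/
  tgt : A →ₗ[k] U
  tgt_one : tgt 1 = 1
  tgt_mul : ∀ a b : A, tgt (a * b) = tgt b * tgt a
  src_tgt_comm : ∀ a b : A, src a * tgt b = tgt b * src a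
  /-- the counit -/
  counit : U →ₗ[k] A
  /-- a choice of Sweedler representatives of the coproduct -/
  comul : U → List (U × U)
  counit_one : counit 1 = 1
  counit_lact : ∀ (a : A) (u : U), counit (src a * u) = a * counit u
  counit_ract : ∀ (a : A) (u : U), counit (tgt a * u) = counit u * a
  counit_mul_src : ∀ u v : U, counit (u * v) = counit (u * src (counit v))
  counit_mul_tgt : ∀ u v : U, counit (u * v) = counit (u * tgt (counit v))
  comul_counit_left : ∀ u : U, ((comul u).map fun p => src (counit p.1) * p.2).sum = u
  comul_counit_right : ∀ u : U, ((comul u).map fun p => tgt (counit p.2) * p.1).sum = u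
  comul_takeuchi : ∀ (u : U) (a : A),
      listTens k U ((comul u).map fun p => (p.1 * tgt a, p.2))
        - listTens k U ((comul u).map fun p => (p.1, p.2 * src a))
        ∈ midSpan k A (src ·) (tgt ·)
  comul_add : ∀ u v : U,
      listTens k U (comul (u + v)) - listTens k U (comul u) - listTens k U (comul v)
        ∈ midSpan k A (src ·) (tgt ·)
  comul_smul : ∀ (c : k) (u : U),
      listTens k U (comul (c • u)) - c • listTens k U (comul u)
        ∈ midSpan k A (src ·) (tgt ·)
  comul_one : listTens k U (comul 1) - (1 : U) ⊗ₜ[k] (1 : U) ∈ midSpan k A (src ·) (tgt ·)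
  comul_mul : ∀ u v : U,
      listTens k U (comul (u * v))
        - ((comul u).map fun p =>
            ((comul v).map fun q => (p.1 * q.1) ⊗ₜ[k] (p.2 * q.2)).sum).sum
        ∈ midSpan k A (src ·) (tgt ·)
  comul_bimod : ∀ (a b : A) (u : U),
      listTens k U (comul (src a * tgt b * u))
        - listTens k U ((comul u).map fun p => (src a * p.1, tgt b * p.2))
        ∈ midSpan k A (src ·) (tgt ·)
  comul_coassoc : ∀ u : U,
      ((comul u).map fun p => ((comul p.1).map fun q => q.1 ⊗ₜ[k] (q.2 ⊗ₜ[k] p.2)).sum).sum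
        - ((comul u).map fun p => ((comul p.2).map fun q => p.1 ⊗ₜ[k] (q.1 ⊗ₜ[k] q.2)).sum).sum
        ∈ midSpan3 k A (src ·) (tgt ·)

variable {k A U}

/-- The data making a left bialgebroid a left Hopf algebroid: a translation map
`u ↦ u₊ ⊗ u₋` (again through a chosen list of representatives), inverting the
Hopf-Galois map, i.e. satisfying Schauenburg's identities. -/
structure HopfData (B : LeftBialgebroid k A U) where
  /-- a choice of representatives `u₊ ⊗ u₋` of the translation map -/
  trans : U → List (U × U)
  trans_add : ∀ u v : U,
      listTens k U (trans (u + v)) - listTens k U (trans u) - listTens k U (trans v)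
        ∈ opSpan k A (B.tgt ·)
  trans_smul : ∀ (c : k) (u : U),
      listTens k U (trans (c • u)) - c • listTens k U (trans u) ∈ opSpan k A (B.tgt ·)
  /-- `u₊₍₁₎ ⊗ u₊₍₂₎ u₋ = u ⊗ 1` -/
  sch_one : ∀ u : U,
      ((trans u).map fun pm =>
          ((B.comul pm.1).map fun xy => xy.1 ⊗ₜ[k] (xy.2 * pm.2)).sum).sum
        - u ⊗ₜ[k] (1 : U) ∈ midSpan k A (B.src ·) (B.tgt ·)
  /-- `u₍₁₎₊ ⊗ u₍₁₎₋ u₍₂₎ = u ⊗ 1` -/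
  sch_two : ∀ u : U,
      ((B.comul u).map fun xy =>
          ((trans xy.1).map fun pm => pm.1 ⊗ₜ[k] (pm.2 * xy.2)).sum).sum
        - u ⊗ₜ[k] (1 : U) ∈ opSpan k A (B.tgt ·)

variable (k) in
/-- A right `U`-module structure on `M`. -/
structure RightUModule (B : LeftBialgebroid k A U) (M : Type u) [AddCommGroup M] [Module k M] where
  act : M →ₗ[k] U →ₗ[k] M
  act_one : ∀ m : M, act m 1 = m
  act_mul : ∀ (m : M) (u v : U), act (act m u) v = act m (u * v)

variable (k) in
/-- Relators in `U ⊗[k] M` presenting `U_◁ ⊗_A ▸M`. -/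
def umSpan (B : LeftBialgebroid k A U) {M : Type u} [AddCommGroup M] [Module k M]
    (R : RightUModule k B M) : Submodule k (U ⊗[k] M) :=
  Submodule.span k {z : U ⊗[k] M | ∃ v m a, z = (B.tgt a * v) ⊗ₜ[k] m - v ⊗ₜ[k] R.act m (B.tgt a)}

variable (k) in
/-- A left `U`-comodule structure on a right `U`-module `M`, making `M` a
module-comodule (with compatible induced left `A`-action). -/
structure ComoduleStr (B : LeftBialgebroid k A U) {M : Type u} [AddCommGroup M] [Module k M]
    (R : RightUModule k B M) where
  /-- a choice of Sweedler representatives `m₍₋₁₎ ⊗ m₍₀₎` of the coaction -/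
  coact : M → List (U × M)
  coact_add : ∀ m m' : M,
      ((coact (m + m')).map fun p => p.1 ⊗ₜ[k] p.2).sum
        - ((coact m).map fun p => p.1 ⊗ₜ[k] p.2).sum
        - ((coact m').map fun p => p.1 ⊗ₜ[k] p.2).sum ∈ umSpan k B R
  coact_smul : ∀ (c : k) (m : M),
      ((coact (c • m)).map fun p => p.1 ⊗ₜ[k] p.2).sum
        - c • ((coact m).map fun p => p.1 ⊗ₜ[k] p.2).sum ∈ umSpan k B R
  coact_counit : ∀ m : M, ((coact m).map fun p => R.act p.2 (B.tgt (B.counit p.1))).sum = m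
  coact_takeuchi : ∀ (m : M) (a : A),
      ((coact m).map fun p => (p.1 * B.tgt a) ⊗ₜ[k] p.2).sum
        - ((coact m).map fun p => p.1 ⊗ₜ[k] R.act p.2 (B.src a)).sum ∈ umSpan k B R

variable (k) in
/-- The anti Yetter-Drinfel'd condition for a module-comodule over a left Hopf algebroid. -/
def IsAYD (B : LeftBialgebroid k A U) (H : HopfData B) {M : Type u} [AddCommGroup M] [Module k M]
    (R : RightUModule k B M) (C : ComoduleStr k B R) : Prop :=
  (∀ (m : M) (u : U),
      ((C.coact (R.act m u)).map fun p => p.1 ⊗ₜ[k] p.2).sum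
        - ((H.trans u).map fun pm =>
            ((C.coact m).map fun xm =>
              ((B.comul pm.1).map fun y =>
                (pm.2 * xm.1 * y.1) ⊗ₜ[k] R.act xm.2 y.2).sum).sum).sum
        ∈ umSpan k B R) ∧
  (∀ (a b : A) (m : M),
      ((C.coact (R.act m (B.src b * B.tgt a))).map fun p => p.1 ⊗ₜ[k] p.2).sum
        - ((C.coact m).map fun p => (B.src a * B.tgt b * p.1) ⊗ₜ[k] p.2).sum
        ∈ umSpan k B R)

variable (k) in
/-- Stability of a module-comodule: `m₍₀₎ m₍₋₁₎ = m`. -/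
def IsStable (B : LeftBialgebroid k A U) {M : Type u} [AddCommGroup M] [Module k M]
    (R : RightUModule k B M) (C : ComoduleStr k B R) : Prop :=
  ∀ m : M, ((C.coact m).map fun p => R.act p.2 p.1).sum = m

end Bialgebroid
section Cochains

variable {k : Type u} [CommRing k] {A U : Type u} [Ring A] [Algebra k A] [Ring U] [Algebra k U]

variable (k) in
/-- The conditions singling out the `p`-cochains `C^p(U,A) = Hom_{A^op}((U^{⊗_{A^op} p})_◁, A)`
inside all maps `(ℕ → U) → A` (a `p`-cochain only depends on the first `p` entries). -/
def cochainCond (B : LeftBialgebroid k A U) (p : ℕ) (φ : (ℕ → U) → A) : Prop :=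
  (∀ u v : ℕ → U, (∀ i < p, u i = v i) → φ u = φ v) ∧
  (∀ (u : ℕ → U) (i : ℕ), i < p → ∀ x y : U,
      φ (update u i (x + y)) = φ (update u i x) + φ (update u i y)) ∧
  (∀ (u : ℕ → U) (i : ℕ), i < p → ∀ (c : k) (x : U),
      φ (update u i (c • x)) = c • φ (update u i x)) ∧
  (∀ (u : ℕ → U) (i : ℕ), i + 1 < p → ∀ a : A,
      φ (update u i (u i * B.tgt a)) = φ (update u (i + 1) (B.tgt a * u (i + 1)))) ∧
  (∀ (u : ℕ → U), 0 < p → ∀ a : A,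
      φ (update u (p - 1) (B.tgt a * u (p - 1))) = φ u * a)

variable (k) in
/-- The `k`-module of `p`-cochains. -/
def cochainSub (B : LeftBialgebroid k A U) (p : ℕ) : Submodule k ((ℕ → U) → A) where
  carrier := {φ | cochainCond k B p φ}
  add_mem' := by
    rintro φ ψ ⟨h1, h2, h3, h4, h5⟩ ⟨g1, g2, g3, g4, g5⟩
    refine ⟨fun u v h => ?_, fun u i hi x y => ?_, fun u i hi c x => ?_,
      fun u i hi a => ?_, fun u hp a => ?_⟩ <;> simp only [Pi.add_apply]
    · rw [h1 u v h, g1 u v h]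
    · rw [h2 u i hi x y, g2 u i hi x y]; abel
    · rw [h3 u i hi c x, g3 u i hi c x, smul_add]
    · rw [h4 u i hi a, g4 u i hi a]
    · rw [h5 u hp a, g5 u hp a, add_mul]
  zero_mem' := by
    refine ⟨fun u v h => rfl, fun u i hi x y => ?_, fun u i hi c x => ?_,
      fun u i hi a => rfl, fun u hp a => ?_⟩ <;> simp
  smul_mem' := by
    rintro c φ ⟨h1, h2, h3, h4, h5⟩
    refine ⟨fun u v h => ?_, fun u i hi x y => ?_, fun u i hi c' x => ?_,
      fun u i hi a => ?_, fun u hp a => ?_⟩ <;> simp only [Pi.smul_apply]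
    · rw [h1 u v h]
    · rw [h2 u i hi x y, smul_add]
    · rw [h3 u i hi c' x, smul_comm]
    · rw [h4 u i hi a]
    · rw [h5 u hp a, smul_mul_assoc]

variable (k) in
/-- Reduced (normalised) cochains: those killed by all codegeneracies. -/
def redCochainSub (p : ℕ) : Submodule k ((ℕ → U) → A) where
  carrier := {φ | ∀ (u : ℕ → U) (i : ℕ), i < p → φ (update u i 1) = 0}
  add_mem' := by
    intro φ ψ hφ hψ
    intro u i hi; simp only [Pi.add_apply, hφ u i hi, hψ u i hi, add_zero]
  zero_mem' := by intro u i hi; rfl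
  smul_mem' := by
    intro c φ hφ u i hi; simp only [Pi.smul_apply, hφ u i hi, smul_zero]

variable (k) in
/-- The operator `D_φ(u¹,…,u^p) = φ(u¹₍₁₎,…,u^p₍₁₎) ▷ u¹₍₂₎ ⋯ u^p₍₂₎`. -/
def Dop (B : LeftBialgebroid k A U) (p : ℕ) (φ : (ℕ → U) → A) (u : ℕ → U) : U :=
  ∑ j : (∀ i : Fin p, Fin ((B.comul (u i.val)).length)),
    B.src (φ fun l => if h : l < p then ((B.comul (u l)).get (j ⟨l, h⟩)).1 else u l) *
      (List.ofFn fun i : Fin p => ((B.comul (u i.val)).get (j i)).2).prod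

variable (k) in
/-- The cosimplicial differential `δ` on cochains. -/
def deltaFun (B : LeftBialgebroid k A U) (p : ℕ) (φ : (ℕ → U) → A) : (ℕ → U) → A :=
  if p = 0 then
    fun u => B.counit (u 0 * B.src (φ fun _ => 1)) - (φ fun _ => 1) * B.counit (u 0)
  else
    fun u =>
      B.counit (u 0 * B.src (φ fun i => u (i + 1)))
        + (∑ i ∈ Finset.Icc 1 p, ((-1 : ℤ) ^ i) •
            φ (fun l => if l < i - 1 then u l else if l = i - 1 then u (i - 1) * u i
                else u (l + 1)))
        + ((-1 : ℤ) ^ (p + 1)) •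
            φ (fun l => if l = p - 1 then u (p - 1) * B.tgt (B.counit (u p)) else u l)

variable (k) in
lemma deltaFun_add (B : LeftBialgebroid k A U) (p : ℕ) (φ ψ : (ℕ → U) → A) :
    deltaFun k B p (φ + ψ) = deltaFun k B p φ + deltaFun k B p ψ := by
  unfold deltaFun
  split
  · funext u
    simp only [Pi.add_apply, map_add, mul_add, add_mul]
    abel
  · funext u
    simp only [Pi.add_apply, map_add, mul_add, smul_add, Finset.sum_add_distrib]
    abel

variable (k) in
lemma deltaFun_smul (B : LeftBialgebroid k A U) (p : ℕ) (c : k) (φ : (ℕ → U) → A) :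
    deltaFun k B p (c • φ) = c • deltaFun k B p φ := by
  unfold deltaFun
  split
  · funext u
    simp only [Pi.smul_apply, map_smul, mul_smul_comm, smul_mul_assoc, smul_sub]
  · funext u
    simp only [Pi.smul_apply, map_smul, mul_smul_comm, smul_add, Finset.smul_sum,
      smul_comm ((-1 : ℤ) ^ _) c]

variable (k) in
lemma deltaFun_zero (B : LeftBialgebroid k A U) (p : ℕ) :
    deltaFun k B p (0 : (ℕ → U) → A) = 0 := by
  have h : (0 : (ℕ → U) → A) = (0 : k) • (0 : (ℕ → U) → A) := by simp
  rw [h, deltaFun_smul]; simp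

variable (k) in
/-- Cocycles: cochains killed by `δ`. -/
def cocycles (B : LeftBialgebroid k A U) (p : ℕ) : Submodule k ((ℕ → U) → A) where
  carrier := {φ | φ ∈ cochainSub k B p ∧ deltaFun k B p φ = 0}
  add_mem' := fun hφ hψ => ⟨(cochainSub k B _).add_mem hφ.1 hψ.1, by
    rw [deltaFun_add, hφ.2, hψ.2, add_zero]⟩
  zero_mem' := ⟨(cochainSub k B _).zero_mem, deltaFun_zero k B _⟩
  smul_mem' := fun c φ hφ => ⟨(cochainSub k B _).smul_mem c hφ.1, by
    rw [deltaFun_smul, hφ.2, smul_zero]⟩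

variable (k) in
/-- Coboundaries: images of cochains under `δ`. -/
def cobounds (B : LeftBialgebroid k A U) : ℕ → Submodule k ((ℕ → U) → A)
  | 0 => ⊥
  | (q + 1) =>
    { carrier := {ψ | ∃ φ ∈ cochainSub k B q, ψ = deltaFun k B q φ}
      add_mem' := by
        rintro ψ₁ ψ₂ ⟨φ₁, hφ₁, rfl⟩ ⟨φ₂, hφ₂, rfl⟩
        exact ⟨φ₁ + φ₂, (cochainSub k B q).add_mem hφ₁ hφ₂, (deltaFun_add k B q φ₁ φ₂).symm⟩
      zero_mem' := ⟨0, (cochainSub k B q).zero_mem, (deltaFun_zero k B q).symm⟩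
      smul_mem' := by
        rintro c ψ ⟨φ, hφ, rfl⟩
        exact ⟨c • φ, (cochainSub k B q).smul_mem c hφ, (deltaFun_smul k B q c φ).symm⟩ }

variable (k) in
/-- The cohomology `H^p(U,A)` of the cochain complex `(C^•(U,A), δ)`. -/
abbrev Hcoh (B : LeftBialgebroid k A U) (p : ℕ) :=
  ↥(cocycles k B p) ⧸ Submodule.comap (cocycles k B p).subtype (cobounds k B p)

variable (k) in
/-- The cohomology class of a cocycle. -/
def clsH (B : LeftBialgebroid k A U) (p : ℕ) (φ : (ℕ → U) → A) (h : φ ∈ cocycles k B p) :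
    Hcoh k B p := Submodule.Quotient.mk ⟨φ, h⟩

variable (k) in
/-- The cup product `(φ ⌣ ψ)(u¹,…,u^{p+q}) = φ(u¹,…,u^{p-1}, ψ(u^{p+1},…,u^{p+q}) ▸ u^p)`. -/
def cupFun (B : LeftBialgebroid k A U) (p q : ℕ) (φ ψ : (ℕ → U) → A) : (ℕ → U) → A :=
  if p = 0 then fun u => (φ fun _ => 1) * ψ u
  else fun u =>
    φ fun l => if l = p - 1 then u (p - 1) * B.tgt (ψ fun i => u (p + i)) else u l

variable (k) in
/-- The Gerstenhaber product `φ ∘ᵢ ψ`, inserting `D_ψ` in the `i`-th slot (`1 ≤ i ≤ p`). -/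
def circFun (B : LeftBialgebroid k A U) (p q i : ℕ) (φ ψ : (ℕ → U) → A) : (ℕ → U) → A :=
  if p = 0 then 0
  else fun u =>
    φ fun l => if l < i - 1 then u l
      else if l = i - 1 then Dop k B q ψ (fun r => u (i - 1 + r))
      else u (l + q - 1)

variable (k) in
/-- `φ ∘̄ ψ = (-1)^{|p||q|} Σᵢ (-1)^{|q||i|} φ ∘ᵢ ψ`. -/
def barCircFun (B : LeftBialgebroid k A U) (p q : ℕ) (φ ψ : (ℕ → U) → A) : (ℕ → U) → A :=
  ((-1 : ℤ) ^ ((p + 1) * (q + 1))) •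
    ∑ i ∈ Finset.Icc 1 p, ((-1 : ℤ) ^ ((q + 1) * (i - 1))) • circFun k B p q i φ ψ

variable (k) in
/-- The Gerstenhaber bracket `{φ,ψ} = φ ∘̄ ψ - (-1)^{|p||q|} ψ ∘̄ φ`. -/
def bracketFun (B : LeftBialgebroid k A U) (p q : ℕ) (φ ψ : (ℕ → U) → A) : (ℕ → U) → A :=
  barCircFun k B p q φ ψ - ((-1 : ℤ) ^ ((p + 1) * (q + 1))) • barCircFun k B q p ψ φ

variable (k) in
/-- The distinguished element `μ = ε ∘ m_U ∈ C²(U,A)`. -/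
def muFun (B : LeftBialgebroid k A U) : (ℕ → U) → A := fun u => B.counit (u 0 * u 1)

end Cochains
section Chains

variable {k : Type u} [CommRing k] {A U : Type u} [Ring A] [Algebra k A] [Ring U] [Algebra k U]
variable {M : Type u} [AddCommGroup M] [Module k M]

variable (k M) in
/-- Generators of the free module underlying the chain modules. -/
def freeGen (m : M) (u : ℕ → U) : (M × (ℕ → U)) →₀ k := Finsupp.single (m, u) 1

variable (k) in
/-- The relators presenting `C_n(U,M) = M ⊗_{A^op} (▸U◁)^{⊗_{A^op} n}` as a quotient of
the free `k`-module on pairs `(m, (u¹,…,uⁿ))` (recorded as sequences `ℕ → U`). -/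
def chainRel (B : LeftBialgebroid k A U) (R : RightUModule k B M) (n : ℕ) :
    Submodule k ((M × (ℕ → U)) →₀ k) :=
  Submodule.span k (
    {x | ∃ m u v, (∀ i < n, u i = v i) ∧ x = freeGen k M m u - freeGen k M m v} ∪
    {x | ∃ m m' u, x = freeGen k M (m + m') u - freeGen k M m u - freeGen k M m' u} ∪
    {x | ∃ (c : k), ∃ m u, x = freeGen k M (c • m) u - c • freeGen k M m u} ∪
    {x | ∃ m u, ∃ i : ℕ, i < n ∧ ∃ y z : U,
        x = freeGen k M m (update u i (y + z)) - freeGen k M m (update u i y)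
            - freeGen k M m (update u i z)} ∪
    {x | ∃ m u, ∃ i : ℕ, i < n ∧ ∃ (c : k) (y : U),
        x = freeGen k M m (update u i (c • y)) - c • freeGen k M m (update u i y)} ∪
    {x | ∃ m u a, 0 < n ∧
        x = freeGen k M (R.act m (B.tgt a)) u - freeGen k M m (update u 0 (B.tgt a * u 0))} ∪
    {x | ∃ m u a, ∃ i : ℕ, i + 1 < n ∧
        x = freeGen k M m (update u i (u i * B.tgt a))
            - freeGen k M m (update u (i + 1) (B.tgt a * u (i + 1)))})

variable (k) in
/-- The chain module `C_n(U,M)`. -/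
abbrev Chn (B : LeftBialgebroid k A U) (R : RightUModule k B M) (n : ℕ) :=
  ((M × (ℕ → U)) →₀ k) ⧸ chainRel k B R n

variable (k) in
/-- The chain modules, indexed over `ℤ` (trivial in negative degrees). -/
def ChZ (B : LeftBialgebroid k A U) (R : RightUModule k B M) : ℤ → Type u := fun z =>
  match z with
  | .ofNat n => Chn k B R n
  | .negSucc _ => PUnit

instance (B : LeftBialgebroid k A U) (R : RightUModule k B M) (z : ℤ) :
    AddCommGroup (ChZ k B R z) :=
  match z with
  | .ofNat n => inferInstanceAs (AddCommGroup (Chn k B R n))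
  | .negSucc _ => inferInstanceAs (AddCommGroup PUnit)

instance (B : LeftBialgebroid k A U) (R : RightUModule k B M) (z : ℤ) :
    Module k (ChZ k B R z) :=
  match z with
  | .ofNat n => inferInstanceAs (Module k (Chn k B R n))
  | .negSucc _ => (inferInstance : Module k PUnit.{u + 1})

variable (k) in
/-- The chain `(m, u¹, …, uⁿ) ∈ C_n(U,M)` (in degree `z ≥ 0`; trivial otherwise). -/
def cgen (B : LeftBialgebroid k A U) (R : RightUModule k B M) (z : ℤ) (m : M) (u : ℕ → U) :
    ChZ k B R z :=
  match z with
  | .ofNat _ => Submodule.Quotient.mk (freeGen k M m u)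
  | .negSucc _ => PUnit.unit

end Chains
section ChainOps

variable {k : Type u} [CommRing k] {A U : Type u} [Ring A] [Algebra k A] [Ring U] [Algebra k U]
variable {M : Type u} [AddCommGroup M] [Module k M]

variable (k) in
/-- The simplicial structure of `C_•(U,M)`, together with the cap product and the
insertion operators `φ •ᵢ -`, given by their values on generators. -/
structure SimplicialOps (B : LeftBialgebroid k A U) (R : RightUModule k B M) where
  face : ∀ (z : ℤ) (_ : ℕ), ChZ k B R z →ₗ[k] ChZ k B R (z - 1)
  degen : ∀ (z : ℤ) (_ : ℕ), ChZ k B R z →ₗ[k] ChZ k B R (z + 1)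
  cap : ∀ (z : ℤ) (p : ℕ), ((ℕ → U) → A) → (ChZ k B R z →ₗ[k] ChZ k B R (z - p))
  bullet : ∀ (z : ℤ) (p i : ℕ), ((ℕ → U) → A) → (ChZ k B R z →ₗ[k] ChZ k B R (z - p + 1))
  face_zero_base : ∀ (m : M) (u : ℕ → U),
      face (1 : ℤ) 0 (cgen k B R 1 m u)
        = cgen k B R ((1 : ℤ) - 1) (R.act m (B.tgt (B.counit (u 0)))) u
  face_zero : ∀ (n : ℕ) (m : M) (u : ℕ → U),
      face ((n : ℤ) + 2) 0 (cgen k B R ((n : ℤ) + 2) m u)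
        = cgen k B R ((n : ℤ) + 2 - 1) m
            (fun l => if l = n then u n * B.tgt (B.counit (u (n + 1))) else u l)
  face_mid : ∀ (n i : ℕ), 1 ≤ i → i ≤ n → ∀ (m : M) (u : ℕ → U),
      face ((n : ℤ) + 1) i (cgen k B R ((n : ℤ) + 1) m u)
        = cgen k B R ((n : ℤ) + 1 - 1) m
            (fun l => if l < n - i then u l
              else if l = n - i then u (n - i) * u (n - i + 1) else u (l + 1))
  face_last : ∀ (n : ℕ) (m : M) (u : ℕ → U),
      face ((n : ℤ) + 1) (n + 1) (cgen k B R ((n : ℤ) + 1) m u)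
        = cgen k B R ((n : ℤ) + 1 - 1) (R.act m (u 0)) (fun l => u (l + 1))
  degen_gen : ∀ (n j : ℕ), j ≤ n → ∀ (m : M) (u : ℕ → U),
      degen (n : ℤ) j (cgen k B R (n : ℤ) m u)
        = cgen k B R ((n : ℤ) + 1) m
            (fun l => if l < n - j then u l else if l = n - j then 1 else u (l - 1))
  cap_add : ∀ (z : ℤ) (p : ℕ) (φ ψ : (ℕ → U) → A),
      cap z p (φ + ψ) = cap z p φ + cap z p ψ
  cap_smul : ∀ (z : ℤ) (p : ℕ) (c : k) (φ : (ℕ → U) → A), cap z p (c • φ) = c • cap z p φ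
  cap_gen : ∀ (n p : ℕ), p < n → ∀ φ ∈ cochainSub k B p, ∀ (m : M) (u : ℕ → U),
      cap (n : ℤ) p φ (cgen k B R (n : ℤ) m u)
        = cgen k B R ((n : ℤ) - p) m
            (fun l => if l = n - p - 1 then
                u (n - p - 1) * B.tgt (φ fun i => u (n - p + i)) else u l)
  cap_top : ∀ (n : ℕ), ∀ φ ∈ cochainSub k B n, ∀ (m : M) (u : ℕ → U),
      cap (n : ℤ) n φ (cgen k B R (n : ℤ) m u)
        = cgen k B R ((n : ℤ) - n) (R.act m (B.tgt (φ u))) u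
  bullet_add : ∀ (z : ℤ) (p i : ℕ) (φ ψ : (ℕ → U) → A),
      bullet z p i (φ + ψ) = bullet z p i φ + bullet z p i ψ
  bullet_smul : ∀ (z : ℤ) (p i : ℕ) (c : k) (φ : (ℕ → U) → A),
      bullet z p i (c • φ) = c • bullet z p i φ
  bullet_gen : ∀ (n p i : ℕ), p ≤ n → 1 ≤ i → i + p ≤ n + 1 → ∀ φ ∈ cochainSub k B p,
      ∀ (m : M) (u : ℕ → U),
      bullet (n : ℤ) p i φ (cgen k B R (n : ℤ) m u)
        = cgen k B R ((n : ℤ) - p + 1) m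
            (fun l => if l < i - 1 then u l
              else if l = i - 1 then Dop k B p φ (fun r => u (i - 1 + r))
              else u (l + p - 1))

variable (k) in
/-- The para-cyclic structure on `C_•(U,M)` for a module-comodule `M` over a left
Hopf algebroid, extending the simplicial operators by the cyclic operator `t`. -/
structure ParaCyclicOps (B : LeftBialgebroid k A U) (H : HopfData B)
    (R : RightUModule k B M) (C : ComoduleStr k B R) extends SimplicialOps k B R where
  cyc : ∀ z : ℤ, ChZ k B R z →ₗ[k] ChZ k B R z
  cyc_gen : ∀ (n : ℕ) (hn : 0 < n) (m : M) (u : ℕ → U),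
      cyc (n : ℤ) (cgen k B R (n : ℤ) m u)
        = ∑ c : Fin (C.coact m).length,
          ∑ j : (∀ i : Fin n, Fin ((H.trans (u i.val)).length)),
            cgen k B R (n : ℤ)
              (R.act ((C.coact m).get c).2 (((H.trans (u 0)).get (j ⟨0, hn⟩)).1))
              (fun l =>
                if h : l + 1 < n then ((H.trans (u (l + 1))).get (j ⟨l + 1, h⟩)).1
                else if l = n - 1 then
                  (List.ofFn fun i : Fin n =>
                      ((H.trans (u (n - 1 - i.val))).get (j ⟨n - 1 - i.val, by omega⟩)).2).prod
                    * ((C.coact m).get c).1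
                else u l)

namespace HopfCalc

variable {B : LeftBialgebroid k A U} {H : HopfData B} {R : RightUModule k B M}
  {C : ComoduleStr k B R}

/-- The simplicial differential `b = Σ (-1)ⁱ dᵢ`. -/
def bOpZ (S : SimplicialOps k B R) (z : ℤ) : ChZ k B R z →ₗ[k] ChZ k B R (z - 1) :=
  ∑ i ∈ Finset.range (z.toNat + 1), ((-1 : ℤ) ^ i) • S.face z i

/-- The operator `T = t^{n+1}`. -/
def TOpZ (P : ParaCyclicOps k B H R C) (z : ℤ) : ChZ k B R z →ₗ[k] ChZ k B R z :=
  (P.cyc z) ^ (z.toNat + 1)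

/-- The submodule `im(id - T)`. -/
def WZ (P : ParaCyclicOps k B H R C) (z : ℤ) : Submodule k (ChZ k B R z) :=
  LinearMap.range (LinearMap.id - TOpZ P z)

/-- The norm operator `N = Σ (-1)^{in} tⁱ`. -/
def NOpZ (P : ParaCyclicOps k B H R C) (z : ℤ) : ChZ k B R z →ₗ[k] ChZ k B R z :=
  ∑ i ∈ Finset.range (z.toNat + 1), ((-1 : ℤ) ^ (i * z.toNat)) • (P.cyc z) ^ i

/-- The extra degeneracy `s₋₁ = t s_n`. -/
def sm1 (P : ParaCyclicOps k B H R C) (z : ℤ) : ChZ k B R z →ₗ[k] ChZ k B R (z + 1) :=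
  P.cyc (z + 1) ∘ₗ P.degen z z.toNat

/-- The cyclic differential `B = (id - t) s₋₁ N`. -/
def BOpZ (P : ParaCyclicOps k B H R C) (z : ℤ) : ChZ k B R z →ₗ[k] ChZ k B R (z + 1) :=
  (LinearMap.id - P.cyc (z + 1)) ∘ₗ sm1 P z ∘ₗ NOpZ P z

/-- The cyclic differential in the form `B = s₋₁ N` valid on the reduced complex. -/
def BredZ (P : ParaCyclicOps k B H R C) (z : ℤ) : ChZ k B R z →ₗ[k] ChZ k B R (z + 1) :=
  sm1 P z ∘ₗ NOpZ P z

/-- The operator `D'_φ = φ •_{n-p+1} -`. -/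
def DlastZ (S : SimplicialOps k B R) (z : ℤ) (p : ℕ) (φ : (ℕ → U) → A) :
    ChZ k B R z →ₗ[k] ChZ k B R (z - p + 1) :=
  S.bullet z p ((z - (p : ℤ) + 1).toNat) φ

/-- The Lie derivative `L_φ`. -/
def lieOpZ (P : ParaCyclicOps k B H R C) (z : ℤ) (p : ℕ) (φ : (ℕ → U) → A) :
    ChZ k B R z →ₗ[k] ChZ k B R (z - p + 1) :=
  if (p : ℤ) ≤ z then
    (∑ i ∈ Finset.Icc 1 ((z - (p : ℤ) + 1).toNat),
        ((-1 : ℤ) ^ ((p + 1) * (z.toNat - i + 1))) •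
          (((P.cyc (z - p + 1)) ^ ((z - (p : ℤ) + 1).toNat - i)) ∘ₗ
            (DlastZ P.toSimplicialOps z p φ ∘ₗ ((P.cyc z) ^ (i + p)))))
    + ∑ i ∈ Finset.Icc 1 p,
        ((-1 : ℤ) ^ (z.toNat * (i - 1) + p + 1)) •
          (((P.cyc (z - p + 1)) ^ ((z - (p : ℤ) + 1).toNat)) ∘ₗ
            (DlastZ P.toSimplicialOps z p φ ∘ₗ ((P.cyc z) ^ i)))
  else if (p : ℤ) = z + 1 then
    ((-1 : ℤ) ^ (p + 1)) •
      ((dEquiv k (ChZ k B R) (by omega : z + 1 - (p : ℤ) = z - p + 1)).toLinearMap ∘ₗ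
        (P.cap (z + 1) p φ ∘ₗ BOpZ P z))
  else 0

/-- The operator `S_φ`. -/
def SOpZ (P : ParaCyclicOps k B H R C) (z : ℤ) (p : ℕ) (φ : (ℕ → U) → A) :
    ChZ k B R z →ₗ[k] ChZ k B R (z - p + 2) :=
  if (p : ℤ) ≤ z then
    ∑ j ∈ Finset.range ((z - (p : ℤ)).toNat + 1), ∑ i ∈ Finset.range (j + 1),
      ((-1 : ℤ) ^ (z.toNat * j + (p + 1) * i)) •
        ((dEquiv k (ChZ k B R) (by omega : z - (p : ℤ) + 1 + 1 = z - p + 2)).toLinearMap ∘ₗ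
          (sm1 P (z - p + 1) ∘ₗ (((P.cyc (z - p + 1)) ^ ((z - (p : ℤ) - i).toNat)) ∘ₗ
          (DlastZ P.toSimplicialOps z p φ ∘ₗ ((P.cyc z) ^ (z.toNat + i - j + 1))))))
  else 0

/-- Cycles of the cyclic quotient complex `C_•^{cyc}(U,M)`. -/
def ZCy (P : ParaCyclicOps k B H R C) (z : ℤ) : Submodule k (ChZ k B R z) :=
  Submodule.comap (bOpZ P.toSimplicialOps z) (WZ P (z - 1))

/-- Boundaries of the cyclic quotient complex. -/
def BdCy (P : ParaCyclicOps k B H R C) (z : ℤ) : Submodule k (ChZ k B R z) :=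
  WZ P z ⊔ LinearMap.range
    ((dEquiv k (ChZ k B R) (by omega : z + 1 - 1 = z)).toLinearMap ∘ₗ
      bOpZ P.toSimplicialOps (z + 1))

/-- The homology `Ĥ^M_•(U)` of the cyclic quotient complex `(C_•^{cyc}(U,M), b)`. -/
abbrev Hcyc (P : ParaCyclicOps k B H R C) (z : ℤ) :=
  ↥(ZCy P z) ⧸ Submodule.comap (ZCy P z).subtype (BdCy P z)

/-- The homology class of a cycle. -/
def clsHcyc (P : ParaCyclicOps k B H R C) (z : ℤ) (x : ChZ k B R z) (hx : x ∈ ZCy P z) :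
    Hcyc P z := Submodule.Quotient.mk ⟨x, hx⟩

/-- Cycles of the plain complex `(C_•(U,M), b)`. -/
def ZPl (S : SimplicialOps k B R) (z : ℤ) : Submodule k (ChZ k B R z) :=
  LinearMap.ker (bOpZ S z)

/-- Boundaries of the plain complex `(C_•(U,M), b)`. -/
def BdPl (S : SimplicialOps k B R) (z : ℤ) : Submodule k (ChZ k B R z) :=
  LinearMap.range
    ((dEquiv k (ChZ k B R) (by omega : z + 1 - 1 = z)).toLinearMap ∘ₗ bOpZ S (z + 1))

/-- The homology `H_•(U,M)` of the complex `(C_•(U,M), b)`. -/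
abbrev HPl (S : SimplicialOps k B R) (z : ℤ) :=
  ↥(ZPl S z) ⧸ Submodule.comap (ZPl S z).subtype (BdPl S z)

/-- The homology class of a cycle. -/
def clsHPl (S : SimplicialOps k B R) (z : ℤ) (x : ChZ k B R z) (hx : x ∈ ZPl S z) :
    HPl S z := Submodule.Quotient.mk ⟨x, hx⟩

/-- The degenerate subcomplex. -/
def DegSub (S : SimplicialOps k B R) (z : ℤ) : Submodule k (ChZ k B R z) :=
  ⨆ j : Fin z.toNat, LinearMap.range
    ((dEquiv k (ChZ k B R) (by omega : z - 1 + 1 = z)).toLinearMap ∘ₗ S.degen (z - 1) j.val)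

/-- The subcomplex `C^•_M(U)` of cochains whose insertion operators preserve `im(id - T)`. -/
def CMsub (P : ParaCyclicOps k B H R C) (p : ℕ) : Submodule k ((ℕ → U) → A) where
  carrier := {φ | ∀ (z : ℤ) (i : ℕ), ∀ x ∈ WZ P z, P.bullet z p i φ x ∈ WZ P (z - p + 1)}
  add_mem' := by
    intro φ ψ hφ hψ z i x hx
    rw [P.bullet_add]
    exact (WZ P _).add_mem (hφ z i x hx) (hψ z i x hx)
  zero_mem' := by
    intro z i x hx
    have h0 : P.bullet z p i (0 : (ℕ → U) → A) = 0 := by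
      have h : (0 : (ℕ → U) → A) = (0 : k) • (0 : (ℕ → U) → A) := by simp
      rw [h, P.bullet_smul]; simp
    rw [h0]; simp only [LinearMap.zero_apply]; exact (WZ P _).zero_mem
  smul_mem' := by
    intro c φ hφ z i x hx
    rw [P.bullet_smul]
    exact (WZ P _).smul_mem c (hφ z i x hx)

/-- Cocycles in `C^•_M(U)`. -/
def cocyclesM (P : ParaCyclicOps k B H R C) (p : ℕ) : Submodule k ((ℕ → U) → A) :=
  cocycles k B p ⊓ CMsub P p

/-- Coboundaries in `C^•_M(U)`. -/
def coboundsM (P : ParaCyclicOps k B H R C) : ℕ → Submodule k ((ℕ → U) → A)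
  | 0 => ⊥
  | (q + 1) =>
    { carrier := {ψ | ∃ φ ∈ cochainSub k B q ⊓ CMsub P q, ψ = deltaFun k B q φ}
      add_mem' := by
        rintro ψ₁ ψ₂ ⟨φ₁, hφ₁, rfl⟩ ⟨φ₂, hφ₂, rfl⟩
        exact ⟨φ₁ + φ₂, Submodule.add_mem _ hφ₁ hφ₂, (deltaFun_add k B q φ₁ φ₂).symm⟩
      zero_mem' := ⟨0, Submodule.zero_mem _, (deltaFun_zero k B q).symm⟩
      smul_mem' := by
        rintro c ψ ⟨φ, hφ, rfl⟩
        exact ⟨c • φ, Submodule.smul_mem _ c hφ, (deltaFun_smul k B q c φ).symm⟩ }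

/-- The cohomology `H^•_M(U)` of the subcomplex `C^•_M(U) ⊆ C^•(U,A)`. -/
abbrev HcohM (P : ParaCyclicOps k B H R C) (p : ℕ) :=
  ↥(cocyclesM P p) ⧸ Submodule.comap (cocyclesM P p).subtype (coboundsM P p)

/-- The cohomology class of a cocycle in `C^•_M(U)`. -/
def clsHM (P : ParaCyclicOps k B H R C) (p : ℕ) (φ : (ℕ → U) → A) (h : φ ∈ cocyclesM P p) :
    HcohM P p := Submodule.Quotient.mk ⟨φ, h⟩

end HopfCalc

end ChainOps

section BarResolution

variable {k : Type u} [CommRing k] {A U : Type u} [Ring A] [Algebra k A] [Ring U] [Algebra k U]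

/-- `U` as a right module over itself (used for the bar resolution `P_n = U^{⊗(n+1)}`). -/
def barR (B : LeftBialgebroid k A U) : RightUModule k B U where
  act := LinearMap.mul k U
  act_one := fun m => mul_one m
  act_mul := fun m u v => mul_assoc m u v

variable (k) in
/-- The bar resolution module `P_n = U^{⊗_{A^op}(n+1)}`. -/
abbrev BarC (B : LeftBialgebroid k A U) (n : ℕ) := Chn k B (barR B) n

variable (k) in
/-- The generator `(u⁰, u¹, …, uⁿ) ∈ P_n`. -/
def bgenC (B : LeftBialgebroid k A U) (n : ℕ) (u : ℕ → U) : BarC k B n :=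
  Submodule.Quotient.mk (freeGen k U (u 0) (fun l => u (l + 1)))

variable (k) in
/-- Relators presenting `P_i ⊗_A P_j` as a quotient of `P_i ⊗[k] P_j`. -/
def barTRel (B : LeftBialgebroid k A U) (i j : ℕ) : Submodule k (BarC k B i ⊗[k] BarC k B j) :=
  Submodule.span k {z | ∃ (a : A) (v w : ℕ → U),
    z = (bgenC k B i (fun l => if l = 0 then B.tgt a * v 0 else v l)) ⊗ₜ[k] (bgenC k B j w)
        - (bgenC k B i v) ⊗ₜ[k] (bgenC k B j (fun l => if l = 0 then B.src a * w 0 else w l))}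

variable (k) in
/-- The `A`-module tensor product `P_i ⊗_A P_j`. -/
abbrev BarT (B : LeftBialgebroid k A U) (i j : ℕ) :=
  (BarC k B i ⊗[k] BarC k B j) ⧸ barTRel k B i j

variable (k) in
/-- The class of a simple tensor in `P_i ⊗_A P_j`. -/
def mkT (B : LeftBialgebroid k A U) (i j : ℕ) (x : BarC k B i) (y : BarC k B j) :
    BarT k B i j := Submodule.Quotient.mk (x ⊗ₜ[k] y)

variable (k) in
/-- Relators presenting `P_a ⊗_A P_b ⊗_A P_c`. -/
def barT3Rel (B : LeftBialgebroid k A U) (a b c : ℕ) :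
    Submodule k (BarC k B a ⊗[k] (BarC k B b ⊗[k] BarC k B c)) :=
  Submodule.span k
    ({z | ∃ (s : A) (v w x : ℕ → U),
        z = (bgenC k B a (fun l => if l = 0 then B.tgt s * v 0 else v l)) ⊗ₜ[k]
              ((bgenC k B b w) ⊗ₜ[k] (bgenC k B c x))
            - (bgenC k B a v) ⊗ₜ[k]
              ((bgenC k B b (fun l => if l = 0 then B.src s * w 0 else w l)) ⊗ₜ[k]
                (bgenC k B c x))} ∪
     {z | ∃ (s : A) (v w x : ℕ → U),
        z = (bgenC k B a v) ⊗ₜ[k]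
              ((bgenC k B b (fun l => if l = 0 then B.tgt s * w 0 else w l)) ⊗ₜ[k]
                (bgenC k B c x))
            - (bgenC k B a v) ⊗ₜ[k]
              ((bgenC k B b w) ⊗ₜ[k]
                (bgenC k B c (fun l => if l = 0 then B.src s * x 0 else x l)))})

variable (k) in
/-- The triple tensor product `P_a ⊗_A P_b ⊗_A P_c`. -/
abbrev BarT3 (B : LeftBialgebroid k A U) (a b c : ℕ) :=
  (BarC k B a ⊗[k] (BarC k B b ⊗[k] BarC k B c)) ⧸ barT3Rel k B a b c

variable (k) in
/-- The class of a simple tensor in `P_a ⊗_A P_b ⊗_A P_c`. -/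
def mk3 (B : LeftBialgebroid k A U) (a b c : ℕ) (x : BarC k B a) (y : BarC k B b)
    (z : BarC k B c) : BarT3 k B a b c := Submodule.Quotient.mk (x ⊗ₜ[k] (y ⊗ₜ[k] z))

variable (k) in
/-- The bar differential `b'` and the components `Δ^P_{n i}` of the coproduct on the
bar resolution, given by their values on generators. -/
structure BarOps (B : LeftBialgebroid k A U) where
  bbar : ∀ n : ℕ, BarC k B (n + 1) →ₗ[k] BarC k B n
  bbar_gen : ∀ (n : ℕ) (u : ℕ → U),
      bbar n (bgenC k B (n + 1) u)
        = (∑ i ∈ Finset.range (n + 1), ((-1 : ℤ) ^ i) •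
            bgenC k B n
              (fun l => if l < i then u l else if l = i then u i * u (i + 1) else u (l + 1)))
          + ((-1 : ℤ) ^ (n + 1)) •
            bgenC k B n
              (fun l => if l = n then u n * B.tgt (B.counit (u (n + 1))) else u l)
  compP : ∀ (n i : ℕ), BarC k B n →ₗ[k] BarT k B i (n - i)
  compP_gen : ∀ (n i : ℕ), i ≤ n → ∀ u : ℕ → U,
      compP n i (bgenC k B n u)
        = ∑ j : (∀ l : Fin (i + 1), Fin ((B.comul (u l.val)).length)),
            mkT k B i (n - i)
              (bgenC k B i
                (fun l => if h : l < i + 1 then ((B.comul (u l)).get (j ⟨l, h⟩)).1 else u l))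
              (bgenC k B (n - i)
                (fun l => if l = 0 then
                    (List.ofFn fun r : Fin (i + 1) => ((B.comul (u r.val)).get (j r)).2).prod
                  else u (l + i)))

end BarResolution

section Statement7

variable {k : Type u} [CommRing k] {A U : Type u} [Ring A] [Algebra k A] [Ring U] [Algebra k U]

variable (k) in
/-- Simultaneous Sweedler first components of a tuple. -/
def swFst (B : LeftBialgebroid k A U) (u : ℕ → U) {m : ℕ}
    (e : ∀ l : Fin m, Fin ((B.comul (u l.val)).length)) : ℕ → U :=
  fun l => if h : l < m then ((B.comul (u l)).get (e ⟨l, h⟩)).1 else u l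

variable (k) in
/-- The ordered product of the Sweedler second components of a tuple. -/
def swSndProd (B : LeftBialgebroid k A U) (u : ℕ → U) {m : ℕ}
    (e : ∀ l : Fin m, Fin ((B.comul (u l.val)).length)) : U :=
  (List.ofFn fun r : Fin m => ((B.comul (u r.val)).get (e r)).2).prod

/-- `Σ t(ε(u₍₂₎ s(a))) u₍₁₎ = u t(a)`. -/
lemma sum_tgt_counit_src (B : LeftBialgebroid k A U) (u : U) (a : A) :
    ((B.comul u).map fun p => B.tgt (B.counit (p.2 * B.src a)) * p.1).sum = u * B.tgt a := by
  let g : U ⊗[k] U →ₗ[k] U :=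
    TensorProduct.lift ((LinearMap.mul k U).flip.compl₂ (B.tgt ∘ₗ B.counit))
  have hg : ∀ x y : U, g (x ⊗ₜ[k] y) = B.tgt (B.counit y) * x := fun x y => by
    simp [g]
  have hker : midSpan k A (B.src ·) (B.tgt ·) ≤ LinearMap.ker g := by
    refine Submodule.span_le.2 ?_
    rintro z ⟨x, y, c, rfl⟩
    simp only [SetLike.mem_coe, LinearMap.mem_ker, map_sub, hg]
    rw [B.counit_lact, B.tgt_mul, mul_assoc, sub_self]
  have h := hker (B.comul_takeuchi u a)
  rw [LinearMap.mem_ker, map_sub, sub_eq_zero] at h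
  simp only [listTens, map_list_sum, List.map_map, Function.comp_def, hg] at h
  rw [← h]
  conv_rhs => rw [← B.comul_counit_right u]
  rw [← List.sum_map_mul_right]
  simp [mul_assoc]

/-- The iterated Sweedler computation behind the cup product formula. -/
lemma sweedler_sum (B : LeftBialgebroid k A U) (u : ℕ → U) (n : ℕ) :
    ∀ (F : (ℕ → U) → A) (_ : ∀ v a, F (update v 0 (B.tgt a * v 0)) = F v * a)
      (_ : ∀ v i, i ≤ n → ∀ x y, F (update v i (x + y)) = F (update v i x) + F (update v i y))
      (_ : ∀ v i, i < n → ∀ a,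
        F (update v i (v i * B.tgt a)) = F (update v (i + 1) (B.tgt a * v (i + 1)))) (x : A),
      (∑ j : (∀ l : Fin (n + 1), Fin ((B.comul (u l.val)).length)),
        F (swFst k B u j) * B.counit (swSndProd k B u j * B.src x))
      = F (update u n (u n * B.tgt x)) := by
  have key : ∀ (m : ℕ) (F : (ℕ → U) → A) (w : ℕ → U) (y : U) (x : A),
      (∀ a b, F (update w m (a + b)) = F (update w m a) + F (update w m b)) →
      (∑ e : Fin (B.comul y).length, F (update w m
        (B.tgt (B.counit (((B.comul y).get e).2 * B.src x)) * ((B.comul y).get e).1)))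
      = F (update w m (y * B.tgt x)) := by
    intro m F w y x hadd
    let g : U →+ A := AddMonoidHom.mk' (fun z => F (update w m z)) hadd
    have h := congrArg g (sum_tgt_counit_src B y x)
    rw [map_list_sum, List.map_map] at h
    change _ = F _ at h
    rw [← h, ← List.sum_ofFn]
    congr 1
    conv_rhs => rw [← List.ofFn_get (B.comul y), List.map_ofFn]
    rfl
  induction n with
  | zero =>
    intro F h0 hadd _ x
    rw [← key 0 F u (u 0) x (hadd u 0 le_rfl)]
    refine Fintype.sum_equiv (Equiv.piUnique
      (fun l : Fin 1 => Fin ((B.comul (u l.val)).length))) _ _ fun j => ?_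
    have := h0 (update u 0 ((B.comul (u 0)).get (j 0)).1)
      (B.counit (((B.comul (u 0)).get (j 0)).2 * B.src x))
    rw [update_self, update_idem] at this
    refine Eq.trans ?_ this.symm
    congr 2
    · funext l
      by_cases hl : l = 0
      · subst hl; simp [swFst]
      · simp [swFst, hl]
    · simp [swSndProd]
  | succ n ih =>
    intro F h0 hadd hbal x
    rw [← key (n + 1) F u (u (n + 1)) x (hadd u (n + 1) le_rfl)]
    rw [← Fintype.sum_equiv (Fin.snocEquiv
      (fun l : Fin (n + 2) => Fin ((B.comul (u l.val)).length))) _ _ (fun _ => rfl)]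
    rw [Fintype.sum_prod_type]
    refine Finset.sum_congr rfl fun e _ => ?_
    change Fin ((B.comul (u (n + 1))).length) at e
    set z := ((B.comul (u (n + 1))).get e) with hz
    have ih' := ih (fun v => F (update v (n + 1) z.1))
      (fun v a => by
        rw [update_comm (by omega), ← h0, update_of_ne (by omega)])
      (fun v i hi x y => by
        simp only [update_comm (show i ≠ n + 1 by omega)]
        exact hadd _ i (by omega) x y)
      (fun v i hi a => by
        simp only [update_comm (show i ≠ n + 1 by omega),
          update_comm (show i + 1 ≠ n + 1 by omega)]
        have := hbal (update v (n + 1) z.1) i (by omega) a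
        rwa [update_of_ne (by omega), update_of_ne (by omega)] at this)
      (B.counit (z.2 * B.src x))
    have hb := hbal (update u (n + 1) z.1) n (by omega) (B.counit (z.2 * B.src x))
    rw [update_self, update_idem, update_of_ne (by omega), update_comm (by omega)] at hb
    rw [← hb, ← ih']
    refine Finset.sum_congr rfl fun j _ => ?_
    congr 1
    · congr 1
      funext l
      by_cases hl : l = n + 1
      · subst hl
        have : (Fin.snocEquiv (fun l : Fin (n + 2) => Fin ((B.comul (u l.val)).length))
          (e, j)) (Fin.last (n + 1)) = e := by simp [Fin.snocEquiv]
        simp only [swFst, update_self]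
        rw [dif_pos (by omega)]
        exact congrArg (fun e => ((B.comul (u (n + 1))).get e).1) this
      · rw [update_of_ne hl]
        unfold swFst
        by_cases hl2 : l < n + 1
        · rw [dif_pos (by omega), dif_pos hl2]
          have : (Fin.snocEquiv (fun l : Fin (n + 2) => Fin ((B.comul (u l.val)).length))
            (e, j)) (Fin.castSucc ⟨l, hl2⟩) = j ⟨l, hl2⟩ := by
            simp only [Fin.snocEquiv, Equiv.coe_fn_mk, Fin.snoc_castSucc]
          exact congrArg (fun e => ((B.comul (u l)).get e).1) this
        · rw [dif_neg (by omega), dif_neg hl2]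
    · have hprod : swSndProd k B u (Fin.snocEquiv
          (fun l : Fin (n + 2) => Fin ((B.comul (u l.val)).length)) (e, j))
          = swSndProd k B u j * z.2 := by
        unfold swSndProd
        rw [List.ofFn_succ', List.concat_eq_append, List.prod_append, List.prod_singleton]
        simp only [Fin.snocEquiv, Equiv.coe_fn_mk, Fin.snoc_castSucc, Fin.snoc_last]
        rfl
      rw [hprod, mul_assoc, B.counit_mul_src]

lemma bgenC_add (B : LeftBialgebroid k A U) (n : ℕ) (v : ℕ → U) (i : ℕ) (hi : i ≤ n) (x y : U) :
    bgenC k B n (update v i (x + y)) = bgenC k B n (update v i x) + bgenC k B n (update v i y) := by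
  rw [← sub_eq_zero, ← sub_sub]
  refine (Submodule.Quotient.mk_eq_zero _).2 (Submodule.subset_span ?_)
  cases i with
  | zero =>
    refine Or.inl (Or.inl (Or.inl (Or.inl (Or.inl (Or.inr ⟨x, y, fun l => v (l + 1), ?_⟩)))))
    simp
  | succ i =>
    refine Or.inl (Or.inl (Or.inl (Or.inr ⟨v 0, fun l => v (l + 1), i, by omega, x, y, ?_⟩)))
    have h : ∀ z, (fun l => update v (i + 1) z (l + 1)) = update (fun l => v (l + 1)) i z := by
      intro z; funext l; simp [update_apply]
    simp [h]

lemma bgenC_bal (B : LeftBialgebroid k A U) (n : ℕ) (v : ℕ → U) (i : ℕ) (hi : i < n) (a : A) :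
    bgenC k B n (update v i (v i * B.tgt a))
      = bgenC k B n (update v (i + 1) (B.tgt a * v (i + 1))) := by
  rw [← sub_eq_zero]
  refine (Submodule.Quotient.mk_eq_zero _).2 (Submodule.subset_span ?_)
  have h : ∀ i z, (fun l => update v (i + 1) z (l + 1)) = update (fun l => v (l + 1)) i z := by
    intro i z; funext l; simp [update_apply]
  cases i with
  | zero =>
    refine Or.inl (Or.inr ⟨v 0, fun l => v (l + 1), a, hi, ?_⟩)
    simp only [h]
    simp [barR]
  | succ i =>
    refine Or.inr ⟨v 0, fun l => v (l + 1), a, i, hi, ?_⟩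
    simp only [h]
    simp

/-- Under the isomorphism `Hom_U(P_p, A) ≅ C^p(U,A)`, `φ̂ ↦ φ := φ̂(1,·)`, the convolution
cup product `(φ̂ ⌣ ψ̂)(c) = φ̂(c₍₁₎)ψ̂(c₍₂₎)` coming from the DG coalgebra structure
`Δ^P` of the bar resolution corresponds to the explicit formula
`(φ ⌣ ψ)(u¹,…,u^{p+q}) = φ(u¹,…,u^{p−1}, ψ(u^{p+1},…,u^{p+q}) ▸ u^p)`. -/
theorem convolution_cup_product_is_explicit_formula
    (k : Type u) [CommRing k] (A U : Type u) [Ring A] [Algebra k A] [Ring U] [Algebra k U]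
    (B : LeftBialgebroid k A U) (p q : ℕ)
    (φh : BarC k B p →ₗ[k] A) (ψh : BarC k B q →ₗ[k] A)
    (hφU : ∀ (v : U) (u : ℕ → U),
      φh (bgenC k B p (fun l => if l = 0 then v * u 0 else u l))
        = B.counit (v * B.src (φh (bgenC k B p u))))
    (hψU : ∀ (v : U) (u : ℕ → U),
      ψh (bgenC k B q (fun l => if l = 0 then v * u 0 else u l))
        = B.counit (v * B.src (ψh (bgenC k B q u)))) :
    ∀ u : ℕ → U,
      (∑ j : (∀ l : Fin (p + 1), Fin ((B.comul (u l.val)).length)),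
        φh (bgenC k B p (swFst k B u j))
          * ψh (bgenC k B q
              (fun l => if l = 0 then swSndProd k B u j else u (l + p))))
      = φh (bgenC k B p
          (fun l => if l = p then
              u p * B.tgt (ψh (bgenC k B q (fun r => if r = 0 then 1 else u (p + r))))
            else u l)) := by
  intro u
  set x := ψh (bgenC k B q (fun r => if r = 0 then 1 else u (p + r))) with hx
  have hψ : ∀ w : U, ψh (bgenC k B q (fun l => if l = 0 then w else u (l + p)))
      = B.counit (w * B.src x) := by
    intro w
    rw [hx, ← hψU]
    congr 2
    funext l
    by_cases hl : l = 0
    · simp [hl]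
    · simp [hl, add_comm]
  simp only [hψ]
  have hupd : ∀ (v : ℕ → U) (i : ℕ) (z : U), (fun l => if l = i then z else v l) = update v i z := by
    intro v i z; funext l; simp [update_apply]
  rw [hupd]
  refine sweedler_sum B u p (fun v => φh (bgenC k B p v)) ?_ ?_ ?_ x
  · intro v a
    have := hφU (B.tgt a) v
    rw [hupd] at this
    have h1 := B.counit_lact (φh (bgenC k B p v)) 1
    rw [mul_one, B.counit_one, mul_one] at h1
    rw [this, B.counit_ract, h1]
  · intro v i hi x y
    simp only [bgenC_add B p v i hi x y, map_add]
  · intro v i hi a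
    simp only [bgenC_bal B p v i hi a]

end Statement7
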